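/- arXiv:1701.06798 — 3 statements merged into one kernel-verified Lean document; each statement's English description precedes it below -/
import Mathlib

section
/- For every commutative associative unital F-algebra R, the map from SL(W)(R) to the group of R-superalgebra automorphisms of K₃ ⊗_F R, sending f ∈ SL(W)(R) to the automorphism fixing a and acting as f on W ⊗_F R, is a group isomorphism. -/
open scoped TensorProduct
noncomputable section
namespace Kac

/-! ### Superalgebra isomorphisms and automorphisms -/

@[ext]
structure SuperIso (S A B : Type) [CommRing S]
    [AddCommGroup A] [Module S A] [Mul A]
    [AddCommGroup B] [Module S B] [Mul B]
    (evA odA : Submodule S A) (evB odB : Submodule S B) : Type where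
  e : A ≃ₗ[S] B
  map_mul' : ∀ x y : A, e (x * y) = e x * e y
  map_even : evA.map e.toLinearMap = evB
  map_odd : odA.map e.toLinearMap = odB

abbrev SuperAut (S A : Type) [CommRing S] [AddCommGroup A] [Module S A] [Mul A]
    (ev od : Submodule S A) := SuperIso S A A ev od ev od

namespace SuperAut

variable {S A : Type} [CommRing S] [AddCommGroup A] [Module S A] [Mul A]
variable {ev od : Submodule S A}

private lemma map_symm {f : A ≃ₗ[S] A} {p : Submodule S A}
    (h : p.map f.toLinearMap = p) : p.map f.symm.toLinearMap = p := by
  have h2 : f.symm.toLinearMap.comp f.toLinearMap = LinearMap.id := by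
    ext x; simp
  calc p.map f.symm.toLinearMap
      = (p.map f.toLinearMap).map f.symm.toLinearMap := by rw [h]
    _ = p.map (f.symm.toLinearMap.comp f.toLinearMap) := by
        rw [Submodule.map_comp]
    _ = p := by rw [h2, Submodule.map_id]

instance : Group (SuperAut S A ev od) where
  one := ⟨LinearEquiv.refl S A, fun _ _ => rfl, Submodule.map_id _, Submodule.map_id _⟩
  mul f g := ⟨g.e.trans f.e,
    fun x y => by simp [LinearEquiv.trans_apply, g.map_mul', f.map_mul'],
    by rw [LinearEquiv.coe_trans, Submodule.map_comp, g.map_even, f.map_even],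
    by rw [LinearEquiv.coe_trans, Submodule.map_comp, g.map_odd, f.map_odd]⟩
  inv f := ⟨f.e.symm,
    fun x y => f.e.injective <| by simp [f.map_mul'],
    map_symm f.map_even, map_symm f.map_odd⟩
  mul_assoc f g h := by apply SuperIso.ext; apply LinearEquiv.ext; intro x; rfl
  one_mul f := by apply SuperIso.ext; apply LinearEquiv.ext; intro x; rfl
  mul_one f := by apply SuperIso.ext; apply LinearEquiv.ext; intro x; rfl
  inv_mul_cancel f := by
    apply SuperIso.ext; apply LinearEquiv.ext; intro x
    exact f.e.symm_apply_apply x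

end SuperAut

/-- The predicate that a pair of submodules `ev`, `od` makes a non-unital
(possibly non-associative) algebra `B` into a superalgebra. -/
def IsSuperalgebra (S B : Type) [CommRing S] [NonUnitalNonAssocRing B] [Module S B]
    (ev od : Submodule S B) : Prop :=
  ev ⊔ od = ⊤ ∧ ev ⊓ od = ⊥ ∧
  (∀ x ∈ ev, ∀ y ∈ ev, x * y ∈ ev) ∧ (∀ x ∈ ev, ∀ y ∈ od, x * y ∈ od) ∧
  (∀ x ∈ od, ∀ y ∈ ev, x * y ∈ od) ∧ (∀ x ∈ od, ∀ y ∈ od, x * y ∈ ev)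

/-! ### Submodules given by vanishing of coordinates -/

def stdSub (S R : Type) [Semiring S] [AddCommGroup R] [Module S R] (n : ℕ)
    (s : Set (Fin n)) : Submodule S (Fin n → R) where
  carrier := {x | ∀ i, i ∉ s → x i = 0}
  add_mem' := fun {a b} ha hb i hi => by
    simp [Pi.add_apply, ha i hi, hb i hi]
  zero_mem' := fun i _ => rfl
  smul_mem' := fun c x hx i hi => by
    simp [Pi.smul_apply, hx i hi]

/-! ### Gradings by abelian groups -/

section Gradings

variable {G H S A : Type} [CommGroup G] [CommGroup H] [CommRing S]
  [AddCommGroup A] [Module S A] [Mul A]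

/-- `comp` is a `G`-grading of the superalgebra `(A, ev, od)`. -/
def IsSuperGrading (ev od : Submodule S A) (comp : G → Submodule S A) : Prop :=
  (letI := Classical.decEq G; DirectSum.IsInternal comp) ∧
  (∀ (g h : G) (x y : A), x ∈ comp g → y ∈ comp h → x * y ∈ comp (g * h)) ∧
  (∀ g, comp g = (comp g ⊓ ev) ⊔ (comp g ⊓ od))

/-- The grading with homogeneous elements `w i` of degrees `d i`. -/
def gradingOf (S : Type) {A G : Type} [CommRing S] [AddCommGroup A] [Module S A]
    [CommGroup G] {n : ℕ} (w : Fin n → A) (d : Fin n → G) : G → Submodule S A :=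
  fun g => Submodule.span S (w '' {i | d i = g})

/-- Isomorphism of two `G`-gradings on a superalgebra. -/
def GradIso (ev od : Submodule S A) (comp comp' : G → Submodule S A) : Prop :=
  ∃ φ : SuperAut S A ev od, ∀ g, (comp g).map φ.e.toLinearMap = comp' g

/-- `Δ` refines `Γ`. -/
def Refines (Δ : H → Submodule S A) (Γ : G → Submodule S A) : Prop :=
  ∀ h, Δ h ≠ ⊥ → ∃ g, Δ h ≤ Γ g

/-- Equivalence of a `G`-grading and an `H`-grading on a superalgebra. -/
def GradEquiv (ev od : Submodule S A) (Γ : G → Submodule S A)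
    (Δ : H → Submodule S A) : Prop :=
  ∃ φ : SuperAut S A ev od, ∃ α : {g : G // Γ g ≠ ⊥} → {h : H // Δ h ≠ ⊥},
    Function.Bijective α ∧
    ∀ g : {g : G // Γ g ≠ ⊥}, (Γ g.1).map φ.e.toLinearMap = Δ (α g).1

/-- A grading is fine if any grading refining it has the same nonzero
homogeneous components. -/
def IsFine (ev od : Submodule S A) (Γ : G → Submodule S A) : Prop :=
  ∀ (H : Type) (_ : CommGroup H) (Δ : H → Submodule S A),
    IsSuperGrading ev od Δ → Refines Δ Γ →
      {p : Submodule S A | p ≠ ⊥ ∧ ∃ h, Δ h = p} =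
      {p : Submodule S A | p ≠ ⊥ ∧ ∃ g, Γ g = p}

end Gradings

/-! ### SL₂ and the semidirect product with C₂ -/

abbrev SL2 (R : Type) [CommRing R] := Matrix.SpecialLinearGroup (Fin 2) R

def swapAut (M : Type) [Monoid M] : MulAut (M × M) := MulEquiv.prodComm

lemma swapAut_sq (M : Type) [Monoid M] : swapAut M * swapAut M = 1 :=
  MulEquiv.ext fun _ => rfl

/-- The action of `C₂ = Multiplicative (ZMod 2)` on `M × M` by swapping the factors. -/
def swapHom (M : Type) [Group M] : Multiplicative (ZMod 2) →* MulAut (M × M) :=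
  MonoidHom.mk' (fun c => if c.toAdd = 0 then 1 else swapAut M) (by
    intro a b
    have key : ∀ c : Multiplicative (ZMod 2),
        c = Multiplicative.ofAdd 0 ∨ c = Multiplicative.ofAdd 1 := by decide
    rcases key a with rfl | rfl <;> rcases key b with rfl | rfl <;>
      simp [← ofAdd_add, swapAut_sq] <;> exact fun h => absurd (by decide) h)

end Kac
/-! ### The (base-changed) Kaplansky superalgebra `K₃ ⊗ R` -/

namespace Kac

section Algebras

variable (F : Type) [Field F] (R : Type) [CommRing R] [Algebra F R]

/-- Coordinates: `0 ↦ a`, `1 ↦ u`, `2 ↦ v`. -/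
def K3A (F : Type) [Field F] (R : Type) [CommRing R] [Algebra F R] : Type := Fin 3 → R

instance : AddCommGroup (K3A F R) := Pi.addCommGroup
instance (S : Type) [Semiring S] [Module S R] : Module S (K3A F R) := Pi.module _ _ _

namespace K3A
variable {F R}

def mulFun (x y : K3A F R) : K3A F R := fun i =>
  match i with
  | ⟨0, _⟩ => x 0 * y 0 + (x 1 * y 2 - x 2 * y 1)
  | ⟨1, _⟩ => algebraMap F R 2⁻¹ * (x 0 * y 1 + y 0 * x 1)
  | ⟨2, _⟩ => algebraMap F R 2⁻¹ * (x 0 * y 2 + y 0 * x 2)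

instance : Mul (K3A F R) := ⟨mulFun⟩

lemma mul_def (x y : K3A F R) : x * y = mulFun x y := rfl

@[simp] lemma add_apply (x y : K3A F R) (i : Fin 3) : (x + y) i = x i + y i := rfl
@[simp] lemma sub_apply (x y : K3A F R) (i : Fin 3) : (x - y) i = x i - y i := rfl
@[simp] lemma neg_apply (x : K3A F R) (i : Fin 3) : (-x) i = -(x i) := rfl
@[simp] lemma zero_apply (i : Fin 3) : (0 : K3A F R) i = 0 := rfl
@[simp] lemma smul_apply (S : Type) [Semiring S] [Module S R] (c : S) (x : K3A F R) (i : Fin 3) :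
    (c • x) i = c • (x i) := rfl

variable (F R)

/-- The even part `R·a`. -/
def even (S : Type) [Semiring S] [Module S R] : Submodule S (K3A F R) := stdSub S R 3 {0}
/-- The odd part `W ⊗ R`. -/
def odd (S : Type) [Semiring S] [Module S R] : Submodule S (K3A F R) := stdSub S R 3 {1, 2}

/-- The element `a`. -/
def aE : K3A F R := ![1, 0, 0]
/-- The element of `W ⊗ R` with coordinates `w` in the symplectic basis `{u, v}`. -/
def wE (w : Fin 2 → R) : K3A F R := ![0, w 0, w 1]

end K3A

/-- `J(W) ⊗ R`; coordinates: `0 ↦ 1`, `1 ↦ u`, `2 ↦ v`. -/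
def JW1A (R : Type) [CommRing R] : Type := Fin 3 → R

instance : AddCommGroup (JW1A R) := Pi.addCommGroup
instance (S : Type) [Semiring S] [Module S R] : Module S (JW1A R) := Pi.module _ _ _

namespace JW1A
variable {R}

def mulFun (x y : JW1A R) : JW1A R := fun i =>
  match i with
  | ⟨0, _⟩ => x 0 * y 0 + (x 1 * y 2 - x 2 * y 1)
  | ⟨1, _⟩ => x 0 * y 1 + y 0 * x 1
  | ⟨2, _⟩ => x 0 * y 2 + y 0 * x 2

instance : Mul (JW1A R) := ⟨mulFun⟩

lemma mul_def (x y : JW1A R) : x * y = mulFun x y := rfl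

@[simp] lemma add_apply (x y : JW1A R) (i : Fin 3) : (x + y) i = x i + y i := rfl
@[simp] lemma sub_apply (x y : JW1A R) (i : Fin 3) : (x - y) i = x i - y i := rfl
@[simp] lemma neg_apply (x : JW1A R) (i : Fin 3) : (-x) i = -(x i) := rfl
@[simp] lemma zero_apply (i : Fin 3) : (0 : JW1A R) i = 0 := rfl
@[simp] lemma smul_apply (S : Type) [Semiring S] [Module S R] (c : S) (x : JW1A R) (i : Fin 3) :
    (c • x) i = c • (x i) := rfl

variable (R)

def even (S : Type) [Semiring S] [Module S R] : Submodule S (JW1A R) := stdSub S R 3 {0}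
def odd (S : Type) [Semiring S] [Module S R] : Submodule S (JW1A R) := stdSub S R 3 {1, 2}

def oneE : JW1A R := ![1, 0, 0]
def wE (w : Fin 2 → R) : JW1A R := ![0, w 0, w 1]

end JW1A

/-- `(K₃ × K₃) ⊗ R`; coordinates `0,1,2` for the first copy (`a,u,v`),
`3,4,5` for the second copy. -/
def K33A (F : Type) [Field F] (R : Type) [CommRing R] [Algebra F R] : Type := Fin 6 → R

instance : AddCommGroup (K33A F R) := Pi.addCommGroup
instance (S : Type) [Semiring S] [Module S R] : Module S (K33A F R) := Pi.module _ _ _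

namespace K33A
variable {F R}

def mulFun (x y : K33A F R) : K33A F R := fun i =>
  match i with
  | ⟨0, _⟩ => x 0 * y 0 + (x 1 * y 2 - x 2 * y 1)
  | ⟨1, _⟩ => algebraMap F R 2⁻¹ * (x 0 * y 1 + y 0 * x 1)
  | ⟨2, _⟩ => algebraMap F R 2⁻¹ * (x 0 * y 2 + y 0 * x 2)
  | ⟨3, _⟩ => x 3 * y 3 + (x 4 * y 5 - x 5 * y 4)
  | ⟨4, _⟩ => algebraMap F R 2⁻¹ * (x 3 * y 4 + y 3 * x 4)
  | ⟨5, _⟩ => algebraMap F R 2⁻¹ * (x 3 * y 5 + y 3 * x 5)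

instance : Mul (K33A F R) := ⟨mulFun⟩

lemma mul_def (x y : K33A F R) : x * y = mulFun x y := rfl

@[simp] lemma add_apply (x y : K33A F R) (i : Fin 6) : (x + y) i = x i + y i := rfl
@[simp] lemma sub_apply (x y : K33A F R) (i : Fin 6) : (x - y) i = x i - y i := rfl
@[simp] lemma neg_apply (x : K33A F R) (i : Fin 6) : (-x) i = -(x i) := rfl
@[simp] lemma zero_apply (i : Fin 6) : (0 : K33A F R) i = 0 := rfl
@[simp] lemma smul_apply (S : Type) [Semiring S] [Module S R] (c : S) (x : K33A F R) (i : Fin 6) :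
    (c • x) i = c • (x i) := rfl

variable (F R)

def even (S : Type) [Semiring S] [Module S R] : Submodule S (K33A F R) := stdSub S R 6 {0, 3}
def odd (S : Type) [Semiring S] [Module S R] : Submodule S (K33A F R) := stdSub S R 6 {1, 2, 4, 5}

/-- The element `(a, 0)`. -/
def aLeft : K33A F R := ![1, 0, 0, 0, 0, 0]
/-- The element `(0, a)`. -/
def aRight : K33A F R := ![0, 0, 0, 1, 0, 0]
/-- The element `(v, w)` of the odd part, `v, w ∈ W ⊗ R`. -/
def oddE (w w' : Fin 2 → R) : K33A F R := ![0, w 0, w 1, 0, w' 0, w' 1]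
/-- The exchange automorphism `(x, y) ↦ (y, x)`. -/
def swapFun (x : K33A F R) : K33A F R := fun i =>
  match i with
  | ⟨0, _⟩ => x 3
  | ⟨1, _⟩ => x 4
  | ⟨2, _⟩ => x 5
  | ⟨3, _⟩ => x 0
  | ⟨4, _⟩ => x 1
  | ⟨5, _⟩ => x 2

end K33A

/-- `(J(W) × J(W)) ⊗ R`. -/
def JW2A (R : Type) [CommRing R] : Type := Fin 6 → R

instance : AddCommGroup (JW2A R) := Pi.addCommGroup
instance (S : Type) [Semiring S] [Module S R] : Module S (JW2A R) := Pi.module _ _ _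

namespace JW2A
variable {R}

def mulFun (x y : JW2A R) : JW2A R := fun i =>
  match i with
  | ⟨0, _⟩ => x 0 * y 0 + (x 1 * y 2 - x 2 * y 1)
  | ⟨1, _⟩ => x 0 * y 1 + y 0 * x 1
  | ⟨2, _⟩ => x 0 * y 2 + y 0 * x 2
  | ⟨3, _⟩ => x 3 * y 3 + (x 4 * y 5 - x 5 * y 4)
  | ⟨4, _⟩ => x 3 * y 4 + y 3 * x 4
  | ⟨5, _⟩ => x 3 * y 5 + y 3 * x 5

instance : Mul (JW2A R) := ⟨mulFun⟩

lemma mul_def (x y : JW2A R) : x * y = mulFun x y := rfl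

@[simp] lemma add_apply (x y : JW2A R) (i : Fin 6) : (x + y) i = x i + y i := rfl
@[simp] lemma sub_apply (x y : JW2A R) (i : Fin 6) : (x - y) i = x i - y i := rfl
@[simp] lemma neg_apply (x : JW2A R) (i : Fin 6) : (-x) i = -(x i) := rfl
@[simp] lemma zero_apply (i : Fin 6) : (0 : JW2A R) i = 0 := rfl
@[simp] lemma smul_apply (S : Type) [Semiring S] [Module S R] (c : S) (x : JW2A R) (i : Fin 6) :
    (c • x) i = c • (x i) := rfl

variable (R)

def even (S : Type) [Semiring S] [Module S R] : Submodule S (JW2A R) := stdSub S R 6 {0, 3}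
def odd (S : Type) [Semiring S] [Module S R] : Submodule S (JW2A R) := stdSub S R 6 {1, 2, 4, 5}

/-- The element `(1, 0)`. -/
def oneLeft : JW2A R := ![1, 0, 0, 0, 0, 0]
/-- The element `(0, 1)`. -/
def oneRight : JW2A R := ![0, 0, 0, 1, 0, 0]
def oddE (w w' : Fin 2 → R) : JW2A R := ![0, w 0, w 1, 0, w' 0, w' 1]
def swapFun (x : JW2A R) : JW2A R := fun i =>
  match i with
  | ⟨0, _⟩ => x 3
  | ⟨1, _⟩ => x 4
  | ⟨2, _⟩ => x 5
  | ⟨3, _⟩ => x 0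
  | ⟨4, _⟩ => x 1
  | ⟨5, _⟩ => x 2

end JW2A

/-- Kac's superalgebra `K₁₀ ⊗ R`.  CoordinatesL `0 ↦ 1`, `1 ↦ a⊗a`,
`2 ↦ u⊗u`, `3 ↦ u⊗v`, `4 ↦ v⊗u`, `5 ↦ v⊗v`, `6 ↦ u⊗a`, `7 ↦ v⊗a`,
`8 ↦ a⊗u`, `9 ↦ a⊗v`. -/
def K10A (F : Type) [Field F] (R : Type) [CommRing R] [Algebra F R] : Type := Fin 10 → R

instance : AddCommGroup (K10A F R) := Pi.addCommGroup
instance (S : Type) [Semiring S] [Module S R] : Module S (K10A F R) := Pi.module _ _ _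

namespace K10A
variable {F R}

def mulFun (x y : K10A F R) : K10A F R := fun i =>
  match i with
  | ⟨0, _⟩ => x 0 * y 0 - algebraMap F R (3/16) * (x 1 * y 1)
      + algebraMap F R (3/4) * (x 2 * y 5 + x 5 * y 2 - x 3 * y 4 - x 4 * y 3)
      - algebraMap F R (3/8) * (x 6 * y 7 - x 7 * y 6 + x 8 * y 9 - x 9 * y 8)
  | ⟨1, _⟩ => x 0 * y 1 + x 1 * y 0 + x 1 * y 1
      - (x 2 * y 5 + x 5 * y 2 - x 3 * y 4 - x 4 * y 3)
      + (x 6 * y 7 - x 7 * y 6) + (x 8 * y 9 - x 9 * y 8)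
  | ⟨2, _⟩ => x 0 * y 2 + x 2 * y 0 + algebraMap F R 4⁻¹ * (x 1 * y 2 + x 2 * y 1)
      + algebraMap F R 4⁻¹ * (x 6 * y 8 - x 8 * y 6)
  | ⟨3, _⟩ => x 0 * y 3 + x 3 * y 0 + algebraMap F R 4⁻¹ * (x 1 * y 3 + x 3 * y 1)
      + algebraMap F R 4⁻¹ * (x 6 * y 9 - x 9 * y 6)
  | ⟨4, _⟩ => x 0 * y 4 + x 4 * y 0 + algebraMap F R 4⁻¹ * (x 1 * y 4 + x 4 * y 1)
      + algebraMap F R 4⁻¹ * (x 7 * y 8 - x 8 * y 7)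
  | ⟨5, _⟩ => x 0 * y 5 + x 5 * y 0 + algebraMap F R 4⁻¹ * (x 1 * y 5 + x 5 * y 1)
      + algebraMap F R 4⁻¹ * (x 7 * y 9 - x 9 * y 7)
  | ⟨6, _⟩ => x 0 * y 6 + x 6 * y 0 + algebraMap F R 2⁻¹ * (x 1 * y 6 + x 6 * y 1)
      + algebraMap F R 2⁻¹ * (x 2 * y 9 + x 9 * y 2) - algebraMap F R 2⁻¹ * (x 3 * y 8 + x 8 * y 3)
  | ⟨7, _⟩ => x 0 * y 7 + x 7 * y 0 + algebraMap F R 2⁻¹ * (x 1 * y 7 + x 7 * y 1)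
      + algebraMap F R 2⁻¹ * (x 4 * y 9 + x 9 * y 4) - algebraMap F R 2⁻¹ * (x 5 * y 8 + x 8 * y 5)
  | ⟨8, _⟩ => x 0 * y 8 + x 8 * y 0 + algebraMap F R 2⁻¹ * (x 1 * y 8 + x 8 * y 1)
      - algebraMap F R 2⁻¹ * (x 2 * y 7 + x 7 * y 2) + algebraMap F R 2⁻¹ * (x 4 * y 6 + x 6 * y 4)
  | ⟨9, _⟩ => x 0 * y 9 + x 9 * y 0 + algebraMap F R 2⁻¹ * (x 1 * y 9 + x 9 * y 1)
      - algebraMap F R 2⁻¹ * (x 3 * y 7 + x 7 * y 3) + algebraMap F R 2⁻¹ * (x 5 * y 6 + x 6 * y 5)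

instance : Mul (K10A F R) := ⟨mulFun⟩

lemma mul_def (x y : K10A F R) : x * y = mulFun x y := rfl

@[simp] lemma add_apply (x y : K10A F R) (i : Fin 10) : (x + y) i = x i + y i := rfl
@[simp] lemma sub_apply (x y : K10A F R) (i : Fin 10) : (x - y) i = x i - y i := rfl
@[simp] lemma neg_apply (x : K10A F R) (i : Fin 10) : (-x) i = -(x i) := rfl
@[simp] lemma zero_apply (i : Fin 10) : (0 : K10A F R) i = 0 := rfl
@[simp] lemma smul_apply (S : Type) [Semiring S] [Module S R] (c : S) (x : K10A F R) (i : Fin 10) :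
    (c • x) i = c • (x i) := rfl

variable (F R)

def even (S : Type) [Semiring S] [Module S R] : Submodule S (K10A F R) :=
  stdSub S R 10 {0, 1, 2, 3, 4, 5}
def odd (S : Type) [Semiring S] [Module S R] : Submodule S (K10A F R) :=
  stdSub S R 10 {6, 7, 8, 9}

/-- The unity `1`. -/
def oneE : K10A F R := ![1, 0, 0, 0, 0, 0, 0, 0, 0, 0]
/-- The element `a ⊗ a`. -/
def aaE : K10A F R := ![0, 1, 0, 0, 0, 0, 0, 0, 0, 0]
/-- The element `v ⊗ w ∈ W ⊗ W`. -/
def wwE (w w' : Fin 2 → R) : K10A F R :=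
  ![0, 0, w 0 * w' 0, w 0 * w' 1, w 1 * w' 0, w 1 * w' 1, 0, 0, 0, 0]
/-- The element `w ⊗ a`, `w ∈ W ⊗ R`. -/
def waE (w : Fin 2 → R) : K10A F R := ![0, 0, 0, 0, 0, 0, w 0, w 1, 0, 0]
/-- The element `a ⊗ w`, `w ∈ W ⊗ R`. -/
def awE (w : Fin 2 → R) : K10A F R := ![0, 0, 0, 0, 0, 0, 0, 0, w 0, w 1]
/-- The exchange automorphism `τ`, `τ(x ⊗ y) = (-1)^{|x||y|} y ⊗ x`. -/
def tauFun (x : K10A F R) : K10A F R := fun i =>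
  match i with
  | ⟨0, _⟩ => x 0
  | ⟨1, _⟩ => x 1
  | ⟨2, _⟩ => -x 2
  | ⟨3, _⟩ => -x 4
  | ⟨4, _⟩ => -x 3
  | ⟨5, _⟩ => -x 5
  | ⟨6, _⟩ => x 8
  | ⟨7, _⟩ => x 9
  | ⟨8, _⟩ => x 6
  | ⟨9, _⟩ => x 7

end K10A

end Algebras

end Kac

namespace Kac

namespace K3A

variable {F : Type} [Field F] {R : Type} [CommRing R] [Algebra F R]

lemma ext_coord {x y : K3A F R} (h₀ : x 0 = y 0) (h₁ : x 1 = y 1) (h₂ : x 2 = y 2) :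
    x = y := by
  funext i
  fin_cases i
  exacts [h₀, h₁, h₂]

@[simp] lemma aE_zero : aE F R 0 = 1 := rfl
@[simp] lemma aE_one : aE F R 1 = 0 := rfl
@[simp] lemma aE_two : aE F R 2 = 0 := rfl
@[simp] lemma wE_zero (w : Fin 2 → R) : wE F R w 0 = 0 := rfl
@[simp] lemma wE_one (w : Fin 2 → R) : wE F R w 1 = w 0 := rfl
@[simp] lemma wE_two (w : Fin 2 → R) : wE F R w 2 = w 1 := rfl

/-- The linear map fixing `a` and acting by the matrix `f` on the odd part. -/
def oddActionLin (F : Type) [Field F] [Algebra F R]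
    (f : Matrix (Fin 2) (Fin 2) R) : K3A F R →ₗ[R] K3A F R where
  toFun x := ![x 0, f 0 0 * x 1 + f 0 1 * x 2, f 1 0 * x 1 + f 1 1 * x 2]
  map_add' x y := by
    refine ext_coord rfl ?_ ?_
    · change f 0 0 * (x 1 + y 1) + f 0 1 * (x 2 + y 2) =
        f 0 0 * x 1 + f 0 1 * x 2 + (f 0 0 * y 1 + f 0 1 * y 2)
      ring
    · change f 1 0 * (x 1 + y 1) + f 1 1 * (x 2 + y 2) =
        f 1 0 * x 1 + f 1 1 * x 2 + (f 1 0 * y 1 + f 1 1 * y 2)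
      ring
  map_smul' c x := by
    refine ext_coord rfl ?_ ?_
    · change f 0 0 * (c * x 1) + f 0 1 * (c * x 2) = c * (f 0 0 * x 1 + f 0 1 * x 2)
      ring
    · change f 1 0 * (c * x 1) + f 1 1 * (c * x 2) = c * (f 1 0 * x 1 + f 1 1 * x 2)
      ring

lemma oddActionLin_zero (f : Matrix (Fin 2) (Fin 2) R) (x : K3A F R) :
    oddActionLin F f x 0 = x 0 := rfl

lemma oddActionLin_one (f : Matrix (Fin 2) (Fin 2) R) (x : K3A F R) :
    oddActionLin F f x 1 = f 0 0 * x 1 + f 0 1 * x 2 := rfl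

lemma oddActionLin_two (f : Matrix (Fin 2) (Fin 2) R) (x : K3A F R) :
    oddActionLin F f x 2 = f 1 0 * x 1 + f 1 1 * x 2 := rfl

lemma oddActionLin_mul (f g : Matrix (Fin 2) (Fin 2) R) :
    oddActionLin F (f * g) = oddActionLin F f ∘ₗ oddActionLin F g := by
  refine LinearMap.ext fun x => ext_coord rfl ?_ ?_ <;>
    simp only [LinearMap.comp_apply, oddActionLin_one, oddActionLin_two, Matrix.mul_apply,
    Fin.sum_univ_two] <;> ring

lemma oddActionLin_id : oddActionLin F (1 : Matrix (Fin 2) (Fin 2) R) = LinearMap.id := by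
  refine LinearMap.ext fun x => ext_coord rfl ?_ ?_ <;>
    simp [oddActionLin_one, oddActionLin_two]

lemma mem_even {x : K3A F R} : x ∈ even F R R ↔ x 1 = 0 ∧ x 2 = 0 := by
  refine ⟨fun h => ⟨h 1 (by simp), h 2 (by simp)⟩, fun h i hi => ?_⟩
  fin_cases i
  exacts [absurd rfl hi, h.1, h.2]

lemma mem_odd {x : K3A F R} : x ∈ odd F R R ↔ x 0 = 0 := by
  refine ⟨fun h => h 0 (by simp), fun h i hi => ?_⟩
  fin_cases i
  exacts [h, absurd (Or.inl rfl) hi, absurd (Or.inr rfl) hi]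

lemma map_even_le (f : Matrix (Fin 2) (Fin 2) R) :
    (even F R R).map (oddActionLin F f) ≤ even F R R := by
  rintro _ ⟨x, hx, rfl⟩
  obtain ⟨h₁, h₂⟩ := mem_even.1 hx
  exact mem_even.2 (by simp [oddActionLin_one, oddActionLin_two, h₁, h₂])

lemma map_odd_le (f : Matrix (Fin 2) (Fin 2) R) :
    (odd F R R).map (oddActionLin F f) ≤ odd F R R := by
  rintro _ ⟨x, hx, rfl⟩
  exact mem_odd.2 (mem_odd.1 hx : x 0 = 0)

lemma oddActionLin_comp_eq_id {f g : SL2 R} (h : f * g = 1) :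
    oddActionLin F f.1 ∘ₗ oddActionLin F g.1 = LinearMap.id := by
  rw [← oddActionLin_mul, ← oddActionLin_id]
  exact congrArg (fun k : SL2 R => oddActionLin F k.1) h

lemma map_eq_of_forall_le {p : Submodule R (K3A F R)}
    (hp : ∀ g : SL2 R, p.map (oddActionLin F g.1) ≤ p) (f : SL2 R) :
    p.map (oddActionLin F f.1) = p := by
  refine (hp f).antisymm ?_
  have h := Submodule.map_mono (f := oddActionLin F f.1) (hp f⁻¹)
  rwa [← Submodule.map_comp, oddActionLin_comp_eq_id (mul_inv_cancel f), Submodule.map_id] at h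

lemma mul_zero_coord (x y : K3A F R) :
    (x * y) 0 = x 0 * y 0 + (x 1 * y 2 - x 2 * y 1) := rfl

lemma mul_one_coord (x y : K3A F R) :
    (x * y) 1 = algebraMap F R 2⁻¹ * (x 0 * y 1 + y 0 * x 1) := rfl

lemma mul_two_coord (x y : K3A F R) :
    (x * y) 2 = algebraMap F R 2⁻¹ * (x 0 * y 2 + y 0 * x 2) := rfl

lemma oddActionLin_map_mul (f : SL2 R) (x y : K3A F R) :
    oddActionLin F f.1 (x * y) = oddActionLin F f.1 x * oddActionLin F f.1 y := by
  have hdet : f.1 0 0 * f.1 1 1 - f.1 0 1 * f.1 1 0 = 1 := by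
    rw [← Matrix.det_fin_two, f.2]
  refine ext_coord ?_ ?_ ?_ <;>
    simp only [oddActionLin_zero, oddActionLin_one, oddActionLin_two, mul_zero_coord,
    mul_one_coord, mul_two_coord]
  · linear_combination (x 2 * y 1 - x 1 * y 2) * hdet
  · ring
  · ring

/-- The superalgebra automorphism fixing `a` and acting by `f` on the odd part. -/
def oddAction (F : Type) [Field F] [Algebra F R] :
    SL2 R →* SuperAut R (K3A F R) (even F R R) (odd F R R) :=
  MonoidHom.mk' (fun f =>
    { e := LinearEquiv.ofLinearMap (oddActionLin F f.1) (oddActionLin F f⁻¹.1)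
        (oddActionLin_comp_eq_id (mul_inv_cancel f)) (oddActionLin_comp_eq_id (inv_mul_cancel f))
      map_mul' := oddActionLin_map_mul f
      map_even := map_eq_of_forall_le (fun g => map_even_le g.1) f
      map_odd := map_eq_of_forall_le (fun g => map_odd_le g.1) f })
    fun f g => SuperIso.ext <| LinearEquiv.ext fun x =>
      LinearMap.congr_fun (oddActionLin_mul f.1 g.1) x

lemma oddAction_apply (f : SL2 R) (x : K3A F R) :
    (oddAction F f).e x = oddActionLin F f.1 x := rfl

lemma oddAction_aE (f : SL2 R) : (oddAction F f).e (aE F R) = aE F R := by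
  rw [oddAction_apply]
  refine ext_coord rfl ?_ ?_ <;> simp [oddActionLin_one, oddActionLin_two]

lemma oddAction_wE (f : SL2 R) (w : Fin 2 → R) :
    (oddAction F f).e (wE F R w) = wE F R (f.1.mulVec w) := by
  rw [oddAction_apply]
  refine ext_coord rfl ?_ ?_ <;>
    simp [oddActionLin_one, oddActionLin_two]

lemma oddAction_injective : Function.Injective (oddAction F (R := R)) := by
  intro f g h
  have key (w : Fin 2 → R) : wE F R (f.1.mulVec w) = wE F R (g.1.mulVec w) := by
    rw [← oddAction_wE, ← oddAction_wE, h]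
  refine Subtype.ext (Matrix.ext_of_mulVec_single fun j => ?_)
  funext i
  fin_cases i
  exacts [congrFun (key _) 1, congrFun (key _) 2]

lemma eq_combination (x : K3A F R) :
    x = x 0 • aE F R + x 1 • wE F R ![1, 0] + x 2 • wE F R ![0, 1] := by
  refine ext_coord ?_ ?_ ?_ <;> simp

lemma aE_mul_aE : aE F R * aE F R = aE F R := by
  refine ext_coord ?_ ?_ ?_ <;>
    simp [mul_zero_coord, mul_one_coord, mul_two_coord]

lemma wE_mul_wE_symplectic : wE F R ![1, 0] * wE F R ![0, 1] = aE F R := by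
  refine ext_coord ?_ ?_ ?_ <;>
    simp [mul_zero_coord, mul_one_coord, mul_two_coord]

section Automorphism

variable (φ : SuperAut R (K3A F R) (even F R R) (odd F R R))

lemma aut_mem_even {x : K3A F R} (hx : x ∈ even F R R) : φ.e x ∈ even F R R :=
  φ.map_even.le (Submodule.mem_map_of_mem hx)

lemma aut_mem_odd {x : K3A F R} (hx : x ∈ odd F R R) : φ.e x ∈ odd F R R :=
  φ.map_odd.le (Submodule.mem_map_of_mem hx)

lemma aE_mem_even : aE F R ∈ even F R R := mem_even.2 ⟨rfl, rfl⟩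

lemma eq_smul_aE {x : K3A F R} (hx : x ∈ even F R R) : x = x 0 • aE F R := by
  obtain ⟨h₁, h₂⟩ := mem_even.1 hx
  refine ext_coord ?_ ?_ ?_ <;> simp [h₁, h₂]

lemma aut_aE : φ.e (aE F R) = aE F R := by
  set ε := φ.e (aE F R) 0
  have hε : φ.e (aE F R) = ε • aE F R := eq_smul_aE (aut_mem_even φ aE_mem_even)
  have hidem : ε = ε * ε := by
    have h := congrFun (φ.map_mul' (aE F R) (aE F R)) 0
    rw [aE_mul_aE, hε] at h
    simpa [mul_zero_coord] using h
  obtain ⟨x, hx, hxa⟩ := φ.map_even.ge (aE_mem_even (F := F) (R := R))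
  have hunit : x 0 * ε = 1 := by
    have h : φ.e x = aE F R := hxa
    rw [eq_smul_aE hx, map_smul, hε] at h
    simpa using congrFun h 0
  have hone : ε = 1 := by linear_combination (1 - ε) * hunit - x 0 * hidem
  rw [hε, hone, one_smul]

lemma exists_oddAction_eq : ∃ f : SL2 R, oddAction F f = φ := by
  set p := φ.e (wE F R ![1, 0])
  set q := φ.e (wE F R ![0, 1])
  have hp : p 0 = 0 := mem_odd.1 (aut_mem_odd φ (mem_odd.2 rfl))
  have hq : q 0 = 0 := mem_odd.1 (aut_mem_odd φ (mem_odd.2 rfl))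
  have hdet : p 1 * q 2 - p 2 * q 1 = 1 := by
    have h := congrFun (φ.map_mul' (wE F R ![1, 0]) (wE F R ![0, 1])) 0
    rw [wE_mul_wE_symplectic, aut_aE, mul_zero_coord] at h
    change 1 = p 0 * q 0 + (p 1 * q 2 - p 2 * q 1) at h
    linear_combination -h - q 0 * hp
  refine ⟨⟨!![p 1, q 1; p 2, q 2], ?_⟩, SuperIso.ext <| LinearEquiv.ext fun x => ?_⟩
  · rw [Matrix.det_fin_two_of]
    linear_combination hdet
  · have hx : φ.e x = x 0 • aE F R + x 1 • p + x 2 • q := by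
      conv_lhs => rw [eq_combination x, map_add, map_add, map_smul, map_smul, map_smul, aut_aE]
    rw [hx]
    change oddActionLin F _ x = _
    refine ext_coord ?_ ?_ ?_ <;>
      simp [oddActionLin_zero, oddActionLin_one, oddActionLin_two, hp, hq, mul_comm]

end Automorphism

end K3A

end Kac

/-! ### STATEMENT 3 -/

open Kac in
/-- For every commutative associative unital `F`-algebra `R`, the map from
`SL(W)(R)` to the group of `R`-superalgebra automorphisms of `K₃ ⊗_F R`
sending `f` to the automorphism fixing `a` and acting as `f` on `W ⊗_F R`
is a group isomorphism.  (`K₃ ⊗_F R` is realized as `K3A F R`, in the basis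
`{a, u, v}`, and `SL(W)(R)` as `SL₂(R)` via the symplectic basis `{u, v}`.) -/
theorem aut_K3_iso_SL2 (F : Type) [Field F] (hchar : (2 : F) ≠ 0)
    (R : Type) [CommRing R] [Algebra F R] :
    ∃ Φ : SL2 R ≃* SuperAut R (K3A F R) (K3A.even F R R) (K3A.odd F R R),
      ∀ f : SL2 R,
        (Φ f).e (K3A.aE F R) = K3A.aE F R ∧
        ∀ w : Fin 2 → R, (Φ f).e (K3A.wE F R w) = K3A.wE F R (f.1.mulVec w) := by
  exact ⟨MulEquiv.ofBijective (K3A.oddAction F) ⟨K3A.oddAction_injective, K3A.exists_oddAction_eq⟩,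
    fun f => ⟨K3A.oddAction_aE f, K3A.oddAction_wE f⟩⟩
end
end

section
/- For f,g ∈ sl(W) (trace-zero F-linear endomorphisms of W), the F-linear map D_{f,g} on K₁₀ determined by D_{f,g}(1)=0 and D_{f,g}(x⊗y) = f̃(x)⊗y + x⊗g̃(y) (where f̃ is the endomorphism of K₃ with f̃(a)=0 and f̃|_W = f, and similarly g̃) is an even derivation of K₁₀, and the map (f,g) ↦ D_{f,g} is an isomorphism of Lie algebras from sl(W) × sl(W) onto the Lie algebra (under commutator) of all even derivations of K₁₀. -/
open scoped TensorProduct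
noncomputable section
namespace Kac

/-- `D` is an even derivation of the superalgebra `(A, ev, od)`. -/
def IsEvenDerivation {S A : Type} [CommRing S] [AddCommGroup A] [Module S A] [Mul A]
    (ev od : Submodule S A) (D : A →ₗ[S] A) : Prop :=
  (∀ x ∈ ev, D x ∈ ev) ∧ (∀ x ∈ od, D x ∈ od) ∧
  ∀ x y : A, D (x * y) = D x * y + x * D y

section Der

variable {F : Type} [Field F]

private lemma vec2_add (a b c d : F) : (![a + b, c + d] : Fin 2 → F) = ![a, c] + ![b, d] := by
  funext i; fin_cases i <;> simp

private lemma vec2_smul (r a b : F) : (![r * a, r * b] : Fin 2 → F) = r • ![a, b] := by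
  funext i; fin_cases i <;> simp

/-- The map `D_{f,g}` on `K₁₀ = K10A F F`, determined by `D(1) = 0` and
`D(x ⊗ y) = f̃(x) ⊗ y + x ⊗ g̃(y)`, where `f̃(a) = 0`, `f̃|_W = f`. -/
def derFun (f g : (Fin 2 → F) →ₗ[F] (Fin 2 → F)) (z : K10A F F) : K10A F F := fun i =>
  match i with
  | ⟨0, _⟩ => 0
  | ⟨1, _⟩ => 0
  | ⟨2, _⟩ => f ![z 2, z 4] 0 + g ![z 2, z 3] 0
  | ⟨3, _⟩ => f ![z 3, z 5] 0 + g ![z 2, z 3] 1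
  | ⟨4, _⟩ => f ![z 2, z 4] 1 + g ![z 4, z 5] 0
  | ⟨5, _⟩ => f ![z 3, z 5] 1 + g ![z 4, z 5] 1
  | ⟨6, _⟩ => f ![z 6, z 7] 0
  | ⟨7, _⟩ => f ![z 6, z 7] 1
  | ⟨8, _⟩ => g ![z 8, z 9] 0
  | ⟨9, _⟩ => g ![z 8, z 9] 1

/-- `D_{f,g}` as a linear endomorphism of `K₁₀`. -/
def der (f g : (Fin 2 → F) →ₗ[F] (Fin 2 → F)) : K10A F F →ₗ[F] K10A F F where
  toFun := derFun f g
  map_add' x y := by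
    funext i
    fin_cases i <;>
      (simp only [derFun, K10A.add_apply, vec2_add, map_add, Pi.add_apply]; try ring)
  map_smul' c x := by
    funext i
    fin_cases i <;>
      (simp only [derFun, RingHom.id_apply, K10A.smul_apply, smul_eq_mul, vec2_smul,
        map_smul, Pi.smul_apply]; try ring)

end Der

end Kac

/-! ### Even derivations of `K₁₀` -/

namespace Kac

section EvenDerivations

variable {F : Type} [Field F]

lemma four_ne_zero_of_two_ne_zero (h : (2 : F) ≠ 0) : (4 : F) ≠ 0 := by
  rw [show (4 : F) = 2 * 2 by norm_num]
  exact mul_ne_zero h h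

lemma vec2_eta {α : Type} (w : Fin 2 → α) : ![w 0, w 1] = w := by
  funext i; fin_cases i <;> rfl

lemma vec2_zero : (![0, 0] : Fin 2 → F) = 0 := by
  funext i; fin_cases i <;> rfl

lemma apply_vec2 (f : (Fin 2 → F) →ₗ[F] (Fin 2 → F)) (a b : F) (i : Fin 2) :
    f ![a, b] i = a * f ![1, 0] i + b * f ![0, 1] i := by
  have h : (![a, b] : Fin 2 → F) = a • ![1, 0] + b • ![0, 1] := by
    funext j; fin_cases j <;> simp
  rw [h, map_add, map_smul, map_smul]
  rfl

lemma trace_fin_two_fun (f : (Fin 2 → F) →ₗ[F] (Fin 2 → F)) :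
    LinearMap.trace F (Fin 2 → F) f = f ![1, 0] 0 + f ![0, 1] 1 := by
  have h₀ : (Pi.single 0 1 : Fin 2 → F) = ![1, 0] := by
    funext j; fin_cases j <;> simp
  have h₁ : (Pi.single 1 1 : Fin 2 → F) = ![0, 1] := by
    funext j; fin_cases j <;> simp
  rw [LinearMap.trace_eq_matrix_trace F (Pi.basisFun F (Fin 2)), Matrix.trace_fin_two]
  simp [h₀, h₁]

lemma der_apply (f g : (Fin 2 → F) →ₗ[F] (Fin 2 → F)) (z : K10A F F) :
    der f g z = derFun f g z := rfl

lemma der_isEvenDerivation {f g : (Fin 2 → F) →ₗ[F] (Fin 2 → F)}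
    (hf : LinearMap.trace F (Fin 2 → F) f = 0) (hg : LinearMap.trace F (Fin 2 → F) g = 0) :
    IsEvenDerivation (K10A.even F F F) (K10A.odd F F F) (der f g) := by
  rw [trace_fin_two_fun] at hf hg
  refine ⟨fun x hx i hi => ?_, fun x hx i hi => ?_, fun x y => ?_⟩
  · have h6 := hx 6 (by simp)
    have h7 := hx 7 (by simp)
    have h8 := hx 8 (by simp)
    have h9 := hx 9 (by simp)
    fin_cases i <;> first
      | rfl
      | (simp only [der_apply, derFun, h6, h7, h8, h9]; simp [vec2_zero])
      | simp at hi
  · have h2 := hx 2 (by simp)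
    have h3 := hx 3 (by simp)
    have h4 := hx 4 (by simp)
    have h5 := hx 5 (by simp)
    fin_cases i <;> first
      | rfl
      | (simp only [der_apply, derFun, h2, h3, h4, h5]; simp [vec2_zero])
      | simp at hi
  · funext i
    fin_cases i <;>
      simp only [der_apply, derFun, K10A.mul_def, K10A.mulFun, K10A.add_apply,
        apply_vec2 f (_ + _), apply_vec2 g (_ + _), apply_vec2 f (_ - _),
        apply_vec2 f (x _), apply_vec2 g (x _), apply_vec2 f (y _), apply_vec2 g (y _),
        eq_neg_of_add_eq_zero_left hf, eq_neg_of_add_eq_zero_left hg] <;>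
      ring

lemma der_waE (f g : (Fin 2 → F) →ₗ[F] (Fin 2 → F)) (w : Fin 2 → F) :
    der f g (K10A.waE F F w) = K10A.waE F F (f w) := by
  funext i
  fin_cases i <;> simp only [der_apply, derFun] <;> simp [K10A.waE, vec2_eta, vec2_zero]

lemma der_awE (f g : (Fin 2 → F) →ₗ[F] (Fin 2 → F)) (w : Fin 2 → F) :
    der f g (K10A.awE F F w) = K10A.awE F F (g w) := by
  funext i
  fin_cases i <;> simp only [der_apply, derFun] <;> simp [K10A.awE, vec2_eta, vec2_zero]

lemma der_injective {f g f' g' : (Fin 2 → F) →ₗ[F] (Fin 2 → F)} (h : der f g = der f' g') :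
    f = f' ∧ g = g' := by
  constructor <;> refine LinearMap.ext fun w => funext fun i => ?_
  · have hw := LinearMap.congr_fun h (K10A.waE F F w)
    rw [der_waE, der_waE] at hw
    fin_cases i
    exacts [congrFun hw 6, congrFun hw 7]
  · have hw := LinearMap.congr_fun h (K10A.awE F F w)
    rw [der_awE, der_awE] at hw
    fin_cases i
    exacts [congrFun hw 8, congrFun hw 9]

lemma der_add (f g f' g' : (Fin 2 → F) →ₗ[F] (Fin 2 → F)) :
    der (f + f') (g + g') = der f g + der f' g' := by
  refine LinearMap.ext fun z => funext fun i => ?_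
  fin_cases i <;> simp only [der_apply, derFun, LinearMap.add_apply, Pi.add_apply,
    K10A.add_apply] <;> ring

lemma der_smul (c : F) (f g : (Fin 2 → F) →ₗ[F] (Fin 2 → F)) :
    der (c • f) (c • g) = c • der f g := by
  refine LinearMap.ext fun z => funext fun i => ?_
  fin_cases i <;> simp only [der_apply, derFun, LinearMap.smul_apply, Pi.smul_apply,
    K10A.smul_apply, smul_eq_mul] <;> ring

lemma der_commutator (f g f' g' : (Fin 2 → F) →ₗ[F] (Fin 2 → F)) :
    der (f ∘ₗ f' - f' ∘ₗ f) (g ∘ₗ g' - g' ∘ₗ g) =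
      der f g ∘ₗ der f' g' - der f' g' ∘ₗ der f g := by
  have comp_apply (p q : (Fin 2 → F) →ₗ[F] (Fin 2 → F)) (a b : F) (i : Fin 2) :
      p (q ![a, b]) i = q ![a, b] 0 * p ![1, 0] i + q ![a, b] 1 * p ![0, 1] i := by
    rw [← apply_vec2]
    exact congrFun (congrArg p (vec2_eta _).symm) i
  refine LinearMap.ext fun z => funext fun i => ?_
  fin_cases i <;> simp only [der_apply, derFun, LinearMap.sub_apply, LinearMap.comp_apply,
    Pi.sub_apply, K10A.sub_apply, comp_apply, apply_vec2 _ (_ + _), apply_vec2 _ (z _)] <;> ring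

namespace K10A

lemma waE_mul_waE (w w' : Fin 2 → F) :
    (waE F F w * waE F F w' : K10A F F) =
      (w 0 * w' 1 - w 1 * w' 0) • (aaE F F - (3 / 8 : F) • oneE F F) := by
  funext i
  fin_cases i <;> simp only [mul_def, mulFun, smul_apply, sub_apply] <;>
    simp [waE, aaE, oneE]
  ring

lemma awE_mul_awE (w w' : Fin 2 → F) :
    (awE F F w * awE F F w' : K10A F F) =
      (w 0 * w' 1 - w 1 * w' 0) • (aaE F F - (3 / 8 : F) • oneE F F) := by
  funext i
  fin_cases i <;> simp only [mul_def, mulFun, smul_apply, sub_apply] <;>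
    simp [awE, aaE, oneE]
  ring

lemma waE_mul_awE (w w' : Fin 2 → F) :
    (waE F F w * awE F F w' : K10A F F) = (4⁻¹ : F) • wwE F F w w' := by
  funext i
  fin_cases i <;> simp only [mul_def, mulFun, smul_apply] <;> simp [waE, awE, wwE]

lemma aaE_mul_aaE :
    (aaE F F * aaE F F : K10A F F) = aaE F F - (3 / 16 : F) • oneE F F := by
  funext i
  fin_cases i <;> simp only [mul_def, mulFun, smul_apply, sub_apply] <;> simp [aaE, oneE]

lemma oneE_mul (x : K10A F F) : oneE F F * x = x := by
  funext i
  fin_cases i <;> simp only [mul_def, mulFun] <;> simp [oneE]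

lemma mul_oneE (x : K10A F F) : x * oneE F F = x := by
  funext i
  fin_cases i <;> simp only [mul_def, mulFun] <;> simp [oneE]

lemma waE_add (w w' : Fin 2 → F) : waE F F (w + w') = waE F F w + waE F F w' := by
  funext i
  fin_cases i <;> simp only [add_apply] <;> simp [waE]

lemma waE_smul (c : F) (w : Fin 2 → F) : waE F F (c • w) = c • waE F F w := by
  funext i
  fin_cases i <;> simp only [smul_apply] <;> simp [waE]

lemma awE_add (w w' : Fin 2 → F) : awE F F (w + w') = awE F F w + awE F F w' := by
  funext i
  fin_cases i <;> simp only [add_apply] <;> simp [awE]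

lemma awE_smul (c : F) (w : Fin 2 → F) : awE F F (c • w) = c • awE F F w := by
  funext i
  fin_cases i <;> simp only [smul_apply] <;> simp [awE]

lemma eq_sum_coords (z : K10A F F) :
    z = z 0 • oneE F F + z 1 • aaE F F + wwE F F ![1, 0] ![z 2, z 3]
      + wwE F F ![0, 1] ![z 4, z 5] + waE F F ![z 6, z 7] + awE F F ![z 8, z 9] := by
  funext i
  fin_cases i <;> simp only [add_apply, smul_apply] <;> simp [oneE, aaE, wwE, waE, awE]

lemma waE_mem_odd (w : Fin 2 → F) : waE F F w ∈ odd F F F := by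
  intro i hi
  fin_cases i <;> first
    | rfl
    | simp at hi

lemma awE_mem_odd (w : Fin 2 → F) : awE F F w ∈ odd F F F := by
  intro i hi
  fin_cases i <;> first
    | rfl
    | simp at hi

lemma coords_of_waE_mul_eq_zero {x y : K10A F F} {w w' : Fin 2 → F} (h4 : (4 : F) ≠ 0)
    (hx : x ∈ odd F F F) (hy : y ∈ odd F F F) (h : x * waE F F w' + waE F F w * y = 0) :
    x 6 * w' 1 - x 7 * w' 0 + (w 0 * y 7 - w 1 * y 6) = 0 ∧
      (w 0 * y 8 = x 8 * w' 0 ∧ w 0 * y 9 = x 9 * w' 0) ∧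
      (w 1 * y 8 = x 8 * w' 1 ∧ w 1 * y 9 = x 9 * w' 1) := by
  have hx0 : x 0 = 0 := hx _ (by simp)
  have hx1 : x 1 = 0 := hx _ (by simp)
  have hy0 : y 0 = 0 := hy _ (by simp)
  have hy1 : y 1 = 0 := hy _ (by simp)
  have cancel {s t : F} (e : -(4⁻¹ * s) + 4⁻¹ * t = 0) : t = s :=
    mul_left_cancel₀ (inv_ne_zero h4) (by linear_combination e)
  have h1 := congrFun h 1
  have h2 := congrFun h 2
  have h3 := congrFun h 3
  have h4 := congrFun h 4
  have h5 := congrFun h 5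
  simp only [add_apply, mul_def, mulFun, hx0, hx1, hy0, hy1] at h1 h2 h3 h4 h5
  simp [waE] at h1 h2 h3 h4 h5
  exact ⟨h1, ⟨cancel h2, cancel h3⟩, cancel h4, cancel h5⟩

lemma coords_of_awE_mul_eq_zero {x y : K10A F F} {w w' : Fin 2 → F} (h4 : (4 : F) ≠ 0)
    (hx : x ∈ odd F F F) (hy : y ∈ odd F F F) (h : x * awE F F w' + awE F F w * y = 0) :
    x 8 * w' 1 - x 9 * w' 0 + (w 0 * y 9 - w 1 * y 8) = 0 ∧
      (x 6 * w' 0 = w 0 * y 6 ∧ x 7 * w' 0 = w 0 * y 7) ∧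
      (x 6 * w' 1 = w 1 * y 6 ∧ x 7 * w' 1 = w 1 * y 7) := by
  have hx0 : x 0 = 0 := hx _ (by simp)
  have hx1 : x 1 = 0 := hx _ (by simp)
  have hy0 : y 0 = 0 := hy _ (by simp)
  have hy1 : y 1 = 0 := hy _ (by simp)
  have cancel {s t : F} (e : 4⁻¹ * s + -(4⁻¹ * t) = 0) : s = t :=
    mul_left_cancel₀ (inv_ne_zero h4) (by linear_combination e)
  have h1 := congrFun h 1
  have h2 := congrFun h 2
  have h3 := congrFun h 3
  have h4 := congrFun h 4
  have h5 := congrFun h 5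
  simp only [add_apply, mul_def, mulFun, hx0, hx1, hy0, hy1] at h1 h2 h3 h4 h5
  simp [awE] at h1 h2 h3 h4 h5
  exact ⟨h1, ⟨cancel h2, cancel h4⟩, cancel h3, cancel h5⟩

lemma aaE_mem_even : aaE F F ∈ even F F F := by
  intro i hi
  fin_cases i <;> first
    | rfl
    | simp at hi

end K10A

open K10A

namespace IsEvenDerivation

variable {D D' : K10A F F →ₗ[F] K10A F F}

lemma map_oneE (hD : IsEvenDerivation (K10A.even F F F) (K10A.odd F F F) D) :
    D (oneE F F) = 0 := by
  have h := hD.2.2 (oneE F F) (oneE F F)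
  rwa [oneE_mul, oneE_mul, mul_oneE, left_eq_add] at h

lemma map_aaE (hchar : (2 : F) ≠ 0)
    (hD : IsEvenDerivation (K10A.even F F F) (K10A.odd F F F) D) :
    D (aaE F F) = 0 := by
  have h := hD.2.2 (aaE F F) (aaE F F)
  have hev := hD.1 _ (aaE_mem_even (F := F))
  rw [aaE_mul_aaE, map_sub, map_smul, hD.map_oneE, smul_zero, sub_zero] at h
  generalize D (aaE F F) = d at h hev
  have h4 := four_ne_zero_of_two_ne_zero hchar
  have h16 : (16 : F) ≠ 0 := by
    rw [show (16 : F) = 4 * 4 by norm_num]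
    exact mul_ne_zero h4 h4
  have e16 : (3 / 16 : F) * 16 = 3 := div_mul_cancel₀ _ h16
  have e4 : (4⁻¹ : F) * 4 = 1 := inv_mul_cancel₀ h4
  have half {x : F} (hx : x = 4⁻¹ * x + 4⁻¹ * x) : x = 0 := by
    have : (2 : F) * x = 0 := by linear_combination 4 * hx + 2 * x * e4
    exact (mul_eq_zero.mp this).resolve_left hchar
  have h0 := congrFun h 0
  have h1 := congrFun h 1
  have hww2 := congrFun h 2
  have hww3 := congrFun h 3
  have hww4 := congrFun h 4
  have hww5 := congrFun h 5
  simp only [K10A.add_apply, mul_def, mulFun] at h0 h1 hww2 hww3 hww4 hww5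
  simp [aaE] at h0 h1 hww2 hww3 hww4 hww5
  have hd0 : d 0 = 0 := by
    have : (4 : F) * d 0 = 0 := by linear_combination 16 * h0 - 2 * d 1 * e16 + 6 * h1
    exact (mul_eq_zero.mp this).resolve_left h4
  funext i
  fin_cases i
  · exact hd0
  · change d 1 = 0
    linear_combination -h1 - 2 * hd0
  · exact half hww2
  · exact half hww3
  · exact half hww4
  · exact half hww5
  all_goals exact hev _ (by simp)

lemma map_waE_mul_waE (hchar : (2 : F) ≠ 0)
    (hD : IsEvenDerivation (K10A.even F F F) (K10A.odd F F F) D) (w w' : Fin 2 → F) :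
    D (waE F F w) * waE F F w' + waE F F w * D (waE F F w') = 0 := by
  rw [← hD.2.2, waE_mul_waE, map_smul, map_sub, map_smul, hD.map_aaE hchar, hD.map_oneE]
  simp

lemma map_awE_mul_awE (hchar : (2 : F) ≠ 0)
    (hD : IsEvenDerivation (K10A.even F F F) (K10A.odd F F F) D) (w w' : Fin 2 → F) :
    D (awE F F w) * awE F F w' + awE F F w * D (awE F F w') = 0 := by
  rw [← hD.2.2, awE_mul_awE, map_smul, map_sub, map_smul, hD.map_aaE hchar, hD.map_oneE]
  simp

/-- An even derivation of `K₁₀` preserves `W ⊗ a`. -/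
lemma map_waE (hchar : (2 : F) ≠ 0)
    (hD : IsEvenDerivation (K10A.even F F F) (K10A.odd F F F) D) (w : Fin 2 → F) :
    D (waE F F w) = waE F F ![D (waE F F w) 6, D (waE F F w) 7] := by
  have h4 := four_ne_zero_of_two_ne_zero hchar
  have hodd (w) := hD.2.1 _ (waE_mem_odd (F := F) w)
  have key (w w' : Fin 2 → F) :=
    (coords_of_waE_mul_eq_zero h4 (hodd w) (hodd w') (hD.map_waE_mul_waE hchar w w')).2
  have hu8 : D (waE F F ![1, 0]) 8 = 0 := by
    simpa using (key ![0, 1] ![1, 0]).2.1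
  have hu9 : D (waE F F ![1, 0]) 9 = 0 := by
    simpa using (key ![0, 1] ![1, 0]).2.2
  have h8 : D (waE F F w) 8 = 0 := by
    simpa [hu8] using (key w ![1, 0]).1.1.symm
  have h9 : D (waE F F w) 9 = 0 := by
    simpa [hu9] using (key w ![1, 0]).1.2.symm
  funext i
  fin_cases i <;> first
    | rfl
    | exact h8
    | exact h9
    | exact hodd w _ (by simp)

/-- An even derivation of `K₁₀` preserves `a ⊗ W`. -/
lemma map_awE (hchar : (2 : F) ≠ 0)
    (hD : IsEvenDerivation (K10A.even F F F) (K10A.odd F F F) D) (w : Fin 2 → F) :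
    D (awE F F w) = awE F F ![D (awE F F w) 8, D (awE F F w) 9] := by
  have h4 := four_ne_zero_of_two_ne_zero hchar
  have hodd (w) := hD.2.1 _ (awE_mem_odd (F := F) w)
  have key (w w' : Fin 2 → F) :=
    (coords_of_awE_mul_eq_zero h4 (hodd w) (hodd w') (hD.map_awE_mul_awE hchar w w')).2
  have hu6 : D (awE F F ![1, 0]) 6 = 0 := by
    simpa using (key ![0, 1] ![1, 0]).2.1.symm
  have hu7 : D (awE F F ![1, 0]) 7 = 0 := by
    simpa using (key ![0, 1] ![1, 0]).2.2.symm
  have h6 : D (awE F F w) 6 = 0 := by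
    simpa [hu6] using (key w ![1, 0]).1.1
  have h7 : D (awE F F w) 7 = 0 := by
    simpa [hu7] using (key w ![1, 0]).1.2
  funext i
  fin_cases i <;> first
    | rfl
    | exact h6
    | exact h7
    | exact hodd w _ (by simp)

/-- Even derivations of `K₁₀` are determined by their restrictions to `W ⊗ a` and `a ⊗ W`. -/
lemma ext_odd (hchar : (2 : F) ≠ 0)
    (hD : IsEvenDerivation (K10A.even F F F) (K10A.odd F F F) D)
    (hD' : IsEvenDerivation (K10A.even F F F) (K10A.odd F F F) D')
    (hwa : ∀ w, D (waE F F w) = D' (waE F F w)) (haw : ∀ w, D (awE F F w) = D' (awE F F w)) :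
    D = D' := by
  have h4 := four_ne_zero_of_two_ne_zero hchar
  have hww (w w' : Fin 2 → F) : D (wwE F F w w') = D' (wwE F F w w') := by
    have h : wwE F F w w' = (4 : F) • (waE F F w * awE F F w' : K10A F F) := by
      rw [waE_mul_awE, smul_smul, mul_inv_cancel₀ h4, one_smul]
    rw [h, map_smul, map_smul, hD.2.2, hD'.2.2, hwa, haw]
  ext1 z
  rw [eq_sum_coords z]
  simp only [map_add, map_smul, hwa, haw, hww, hD.map_oneE, hD'.map_oneE, hD.map_aaE hchar,
    hD'.map_aaE hchar]

lemma exists_eq_der (hchar : (2 : F) ≠ 0)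
    (hD : IsEvenDerivation (K10A.even F F F) (K10A.odd F F F) D) :
    ∃ f g : (Fin 2 → F) →ₗ[F] (Fin 2 → F),
      LinearMap.trace F (Fin 2 → F) f = 0 ∧ LinearMap.trace F (Fin 2 → F) g = 0 ∧
      D = der f g := by
  let f : (Fin 2 → F) →ₗ[F] (Fin 2 → F) :=
    { toFun := fun w => ![D (waE F F w) 6, D (waE F F w) 7]
      map_add' := fun w w' => by simp [waE_add]
      map_smul' := fun c w => by simp [waE_smul] }
  let g : (Fin 2 → F) →ₗ[F] (Fin 2 → F) :=
    { toFun := fun w => ![D (awE F F w) 8, D (awE F F w) 9]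
      map_add' := fun w w' => by simp [awE_add]
      map_smul' := fun c w => by simp [awE_smul] }
  have hf : LinearMap.trace F (Fin 2 → F) f = 0 := by
    have h := (coords_of_waE_mul_eq_zero (four_ne_zero_of_two_ne_zero hchar)
      (hD.2.1 _ (waE_mem_odd ![1, 0])) (hD.2.1 _ (waE_mem_odd ![0, 1]))
      (hD.map_waE_mul_waE hchar _ _)).1
    rw [trace_fin_two_fun]
    simpa [f] using h
  have hg : LinearMap.trace F (Fin 2 → F) g = 0 := by
    have h := (coords_of_awE_mul_eq_zero (four_ne_zero_of_two_ne_zero hchar)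
      (hD.2.1 _ (awE_mem_odd ![1, 0])) (hD.2.1 _ (awE_mem_odd ![0, 1]))
      (hD.map_awE_mul_awE hchar _ _)).1
    rw [trace_fin_two_fun]
    simpa [g] using h
  refine ⟨f, g, hf, hg, ext_odd hchar hD (der_isEvenDerivation hf hg) (fun w => ?_) fun w => ?_⟩
  · rw [der_waE, hD.map_waE hchar]
    rfl
  · rw [der_awE, hD.map_awE hchar]
    rfl

end IsEvenDerivation

end EvenDerivations

end Kac

/-! ### STATEMENT 4 -/

open Kac in
/-- For trace-zero `f, g` on `W`, the map `D_{f,g}` (with `D(1) = 0`,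
`D(x⊗y) = f̃(x)⊗y + x⊗g̃(y)`) is an even derivation of `K₁₀`, and
`(f,g) ↦ D_{f,g}` is an isomorphism of Lie algebras from `sl(W) × sl(W)` onto
the Lie algebra (under commutators) of all even derivations of `K₁₀`:
it is linear, bracket-preserving, injective, and surjective onto the even
derivations.  Here `K₁₀` is realized as `K10A F F` and `W` as `Fin 2 → F` via
the symplectic basis `{u, v}`. -/
theorem even_derivations_of_K10 (F : Type) [Field F] (hchar : (2 : F) ≠ 0) :
    (∀ f g : (Fin 2 → F) →ₗ[F] (Fin 2 → F),
      LinearMap.trace F (Fin 2 → F) f = 0 → LinearMap.trace F (Fin 2 → F) g = 0 →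
      IsEvenDerivation (K10A.even F F F) (K10A.odd F F F) (der f g)) ∧
    (∀ f g f' g' : (Fin 2 → F) →ₗ[F] (Fin 2 → F),
      LinearMap.trace F (Fin 2 → F) f = 0 → LinearMap.trace F (Fin 2 → F) g = 0 →
      LinearMap.trace F (Fin 2 → F) f' = 0 → LinearMap.trace F (Fin 2 → F) g' = 0 →
      der f g = der f' g' → f = f' ∧ g = g') ∧
    (∀ f g f' g' : (Fin 2 → F) →ₗ[F] (Fin 2 → F),
      der (f + f') (g + g') = der f g + der f' g') ∧
    (∀ (c : F) (f g : (Fin 2 → F) →ₗ[F] (Fin 2 → F)),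
      der (c • f) (c • g) = c • der f g) ∧
    (∀ f g f' g' : (Fin 2 → F) →ₗ[F] (Fin 2 → F),
      der (f ∘ₗ f' - f' ∘ₗ f) (g ∘ₗ g' - g' ∘ₗ g) =
        der f g ∘ₗ der f' g' - der f' g' ∘ₗ der f g) ∧
    (∀ D : K10A F F →ₗ[F] K10A F F,
      IsEvenDerivation (K10A.even F F F) (K10A.odd F F F) D →
      ∃ f g : (Fin 2 → F) →ₗ[F] (Fin 2 → F),
        LinearMap.trace F (Fin 2 → F) f = 0 ∧ LinearMap.trace F (Fin 2 → F) g = 0 ∧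
        D = der f g) := by
  exact ⟨fun _ _ hf hg => der_isEvenDerivation hf hg, fun _ _ _ _ _ _ _ _ h => der_injective h,
    fun f g f' g' => der_add f g f' g', der_smul, der_commutator,
    fun _ hD => hD.exists_eq_der hchar⟩
end
end

section
/- Let H be a twisted form of J(W) × J(W) over F. If the even part H₀ is isomorphic to F × F as an F-algebra, then H is isomorphic to J(W) × J(W) as an F-superalgebra. -/
open scoped TensorProduct
noncomputable section
namespace Kac

/-- `p` (a submodule of `B`, e.g. the even part) is isomorphic, as an
`F`-algebra, to `C`: there is an `F`-linear bijection preserving products. -/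
def SubAlgIso (F B C : Type) [Field F] [NonUnitalNonAssocRing B] [Module F B]
    [Ring C] [Algebra F C] (p : Submodule F B) : Prop :=
  ∃ e : p ≃ₗ[F] C, ∀ (x y : p) (h : (x : B) * (y : B) ∈ p),
    e ⟨(x : B) * (y : B), h⟩ = e x * e y

/-- A quadratic étale `F`-algebra: two-dimensional, and either isomorphic to
`F × F` or a (quadratic) separable field extension of `F`. -/
def IsQuadraticEtale (F K : Type) [Field F] [CommRing K] [Algebra F K] : Prop :=
  Module.finrank F K = 2 ∧
    (Nonempty (K ≃ₐ[F] (F × F)) ∨ (IsField K ∧ Algebra.IsSeparable F K))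

end Kac

namespace Kac

section Descent

variable {F K H : Type} [Field F] [Field K] [Algebra F K]
  [NonUnitalNonAssocRing H] [Module F H]

namespace JW2A

lemma ext_coords {R : Type} [CommRing R] {x y : JW2A R} (h0 : x 0 = y 0) (h1 : x 1 = y 1)
    (h2 : x 2 = y 2) (h3 : x 3 = y 3) (h4 : x 4 = y 4) (h5 : x 5 = y 5) : x = y := by
  funext i
  fin_cases i <;> assumption

section Coordinates

variable {R : Type} [CommRing R] (x y : JW2A R)

lemma mul_apply_zero : (x * y) 0 = x 0 * y 0 + (x 1 * y 2 - x 2 * y 1) := rfl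
lemma mul_apply_one : (x * y) 1 = x 0 * y 1 + y 0 * x 1 := rfl
lemma mul_apply_two : (x * y) 2 = x 0 * y 2 + y 0 * x 2 := rfl
lemma mul_apply_three : (x * y) 3 = x 3 * y 3 + (x 4 * y 5 - x 5 * y 4) := rfl
lemma mul_apply_four : (x * y) 4 = x 3 * y 4 + y 3 * x 4 := rfl
lemma mul_apply_five : (x * y) 5 = x 3 * y 5 + y 3 * x 5 := rfl

end Coordinates

lemma mem_even_iff {R S : Type} [CommRing R] [Semiring S] [Module S R] {x : JW2A R} :
    x ∈ even R S ↔ x 1 = 0 ∧ x 2 = 0 ∧ x 4 = 0 ∧ x 5 = 0 := by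
  constructor
  · intro h
    exact ⟨h 1 (by decide), h 2 (by decide), h 4 (by decide), h 5 (by decide)⟩
  · rintro ⟨h1, h2, h4, h5⟩ i hi
    fin_cases i <;> simp_all

lemma mem_odd_iff {R S : Type} [CommRing R] [Semiring S] [Module S R] {x : JW2A R} :
    x ∈ odd R S ↔ x 0 = 0 ∧ x 3 = 0 := by
  constructor
  · intro h
    exact ⟨h 0 (by simp), h 3 (by simp)⟩
  · rintro ⟨h0, h3⟩ i hi
    fin_cases i <;> simp_all

/-- If a set of vectors spans a subspace on which the form `x i * y j - x j * y i` does not vanish,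
then the form does not vanish on the set. -/
lemma exists_minor_ne_zero {s : Set (JW2A K)} {x y : JW2A K} (i j : Fin 6)
    (hx : x ∈ Submodule.span K s) (hy : y ∈ Submodule.span K s)
    (h : x i * y j - x j * y i ≠ 0) :
    ∃ a ∈ s, ∃ b ∈ s, a i * b j - a j * b i ≠ 0 := by
  by_contra! hs
  apply h
  clear h
  induction hx, hy using Submodule.span_induction₂ with
  | mem_mem a b ha hb => exact hs a ha b hb
  | zero_left b hb => simp
  | zero_right a ha => simp
  | add_left a b c _ _ _ h1 h2 => simp only [add_apply]; linear_combination h1 + h2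
  | add_right a b c _ _ _ h1 h2 => simp only [add_apply]; linear_combination h1 + h2
  | smul_left r a b _ _ h => simp only [smul_apply, smul_eq_mul]; linear_combination r * h
  | smul_right r a b _ _ h => simp only [smul_apply, smul_eq_mul]; linear_combination r * h

end JW2A

open JW2A

/-- An even part isomorphic to `F × F` is spanned by two idempotents which an embedding
into `J(W) × J(W)` sends to `(1, 0)` and `(0, 1)`. -/
lemma exists_split_idempotents {ev : Submodule F H} (hmem : ∀ x ∈ ev, ∀ y ∈ ev, x * y ∈ ev)
    (hsplit : SubAlgIso F H (F × F) ev) (ι : H →ₗ[F] JW2A K) (hinj : Function.Injective ι)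
    (hmul : ∀ x y, ι (x * y) = ι x * ι y) (hev : ∀ x ∈ ev, ι x ∈ JW2A.even K K) :
    ∃ p ∈ ev, ∃ q ∈ ev, ι p = oneLeft K ∧ ι q = oneRight K ∧
      ∀ z ∈ ev, ∃ a b : F, z = a • p + b • q := by
  obtain ⟨e, he⟩ := hsplit
  have key : ∀ c d : F × F, ((e.symm c : ev) : H) * (e.symm d : ev) = (e.symm (c * d) : ev) := by
    intro c d
    have h := hmem _ (e.symm c).2 _ (e.symm d).2
    have h2 := he (e.symm c) (e.symm d) h
    simp only [LinearEquiv.apply_symm_apply] at h2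
    rw [← h2, LinearEquiv.symm_apply_apply]
  have hspan : ∀ z ∈ ev, ∃ a b : F,
      z = a • ((e.symm (1, 0) : ev) : H) + b • ((e.symm (0, 1) : ev) : H) := by
    intro z hz
    refine ⟨(e ⟨z, hz⟩).1, (e ⟨z, hz⟩).2, ?_⟩
    have : (⟨z, hz⟩ : ev) = (e ⟨z, hz⟩).1 • e.symm (1, 0) + (e ⟨z, hz⟩).2 • e.symm (0, 1) := by
      apply e.injective
      simp
    simpa using congrArg Subtype.val this
  have hp := (e.symm (1, 0)).2
  have hq := (e.symm (0, 1)).2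
  have hpp := key (1, 0) (1, 0)
  have hqq := key (0, 1) (0, 1)
  have hpq := key (1, 0) (0, 1)
  have hp0 : ((e.symm (1, 0) : ev) : H) ≠ 0 := by simp
  have hq0 : ((e.symm (0, 1) : ev) : H) ≠ 0 := by simp
  simp only [Prod.mk_mul_mk, mul_one, mul_zero] at hpp hqq hpq
  rw [Prod.mk_zero_zero, map_zero, ZeroMemClass.coe_zero] at hpq
  generalize ((e.symm (1, 0) : ev) : H) = p at *
  generalize ((e.symm (0, 1) : ev) : H) = q at *
  obtain ⟨p1, p2, p4, p5⟩ := mem_even_iff.1 (hev p hp)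
  obtain ⟨q1, q2, q4, q5⟩ := mem_even_iff.1 (hev q hq)
  have hpp' := hmul p p
  have hqq' := hmul q q
  have hpq' := hmul p q
  rw [hpp] at hpp'
  rw [hqq] at hqq'
  rw [hpq, map_zero] at hpq'
  have a0 := congrFun hpp' 0
  have a3 := congrFun hpp' 3
  have b0 := congrFun hqq' 0
  have b3 := congrFun hqq' 3
  have c0 := congrFun hpq'.symm 0
  have c3 := congrFun hpq'.symm 3
  simp only [mul_apply_zero, mul_apply_three, JW2A.zero_apply, p1, p2, p4, p5, q1, q2, q4, q5,
    mul_zero, sub_zero, add_zero] at a0 a3 b0 b3 c0 c3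
  have ne_zero : ∀ z : H, z ≠ 0 → ι z 1 = 0 → ι z 2 = 0 → ι z 4 = 0 → ι z 5 = 0 →
      ¬ (ι z 0 = 0 ∧ ι z 3 = 0) := by
    rintro z hz h1 h2 h4 h5 ⟨h0, h3⟩
    apply hz
    apply hinj
    rw [map_zero]
    exact ext_coords h0 h1 h2 h3 h4 h5
  have hp' := ne_zero p hp0 p1 p2 p4 p5
  have hq' := ne_zero q hq0 q1 q2 q4 q5
  have idem : ∀ {t : K}, t = t * t → t = 0 ∨ t = 1 := by
    intro t ht
    rcases mul_eq_zero.1 (show t * (t - 1) = 0 by linear_combination -ht) with h | h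
    · exact .inl h
    · exact .inr (sub_eq_zero.1 h)
  have hcases : (ι p 0 = 1 ∧ ι p 3 = 0 ∧ ι q 0 = 0 ∧ ι q 3 = 1) ∨
      (ι p 0 = 0 ∧ ι p 3 = 1 ∧ ι q 0 = 1 ∧ ι q 3 = 0) := by
    have ha0 := idem a0
    have ha3 := idem a3
    have hb0 := idem b0
    have hb3 := idem b3
    clear * - ha0 ha3 hb0 hb3 c0 c3 hp' hq'
    rcases ha0 with h | h <;> rcases ha3 with h' | h' <;>
      rcases hb0 with k | k <;> rcases hb3 with k' | k' <;> simp_all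
  rcases hcases with ⟨h0, h3, k0, k3⟩ | ⟨h0, h3, k0, k3⟩
  · exact ⟨p, hp, q, hq, ext_coords h0 p1 p2 h3 p4 p5, ext_coords k0 q1 q2 k3 q4 q5, hspan⟩
  · refine ⟨q, hq, p, hp, ext_coords k0 q1 q2 k3 q4 q5, ext_coords h0 p1 p2 h3 p4 p5, ?_⟩
    intro z hz
    obtain ⟨a, b, h⟩ := hspan z hz
    exact ⟨b, a, by rw [h, add_comm]⟩

/-- A superalgebra of dimension six with even part `F × F` which embeds into
`(J(W) × J(W)) ⊗ K`, with odd part spanning the odd part, is isomorphic to `J(W) × J(W)`. -/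
lemma nonempty_superIso_of_embedding [FiniteDimensional F H] {ev od : Submodule F H}
    (hsuper : IsSuperalgebra F H ev od) (hsplit : SubAlgIso F H (F × F) ev)
    (hdim : Module.finrank F H = 6)
    (ι : H →ₗ[F] JW2A K) (hinj : Function.Injective ι)
    (hmul : ∀ x y, ι (x * y) = ι x * ι y) (hev : ∀ x ∈ ev, ι x ∈ JW2A.even K K)
    (hod : ∀ x ∈ od, ι x ∈ JW2A.odd K K)
    (hspan : JW2A.odd K K ≤ Submodule.span K (ι '' od)) :
    Nonempty (SuperIso F H (JW2A F) ev od (JW2A.even F F) (JW2A.odd F F)) := by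
  obtain ⟨-, hdisj, hee, heo, -, hoo⟩ := hsuper
  obtain ⟨p, hp, q, hq, hιp, hιq, hpq⟩ := exists_split_idempotents hee hsplit ι hinj hmul hev
  have smulK : ∀ (c : F) (x : JW2A K) (i : Fin 6), (c • x) i = algebraMap F K c * x i := by
    intro c x i
    rw [JW2A.smul_apply, Algebra.smul_def]
  have p0 : ι p 0 = 1 := by rw [hιp]; rfl
  have p1 : ι p 1 = 0 := by rw [hιp]; rfl
  have p2 : ι p 2 = 0 := by rw [hιp]; rfl
  have p3 : ι p 3 = 0 := by rw [hιp]; rfl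
  have p4 : ι p 4 = 0 := by rw [hιp]; rfl
  have p5 : ι p 5 = 0 := by rw [hιp]; rfl
  have q0 : ι q 0 = 0 := by rw [hιq]; rfl
  have q1 : ι q 1 = 0 := by rw [hιq]; rfl
  have q2 : ι q 2 = 0 := by rw [hιq]; rfl
  have q3 : ι q 3 = 1 := by rw [hιq]; rfl
  have q4 : ι q 4 = 0 := by rw [hιq]; rfl
  have q5 : ι q 5 = 0 := by rw [hιq]; rfl
  have left : ∃ u ∈ od, ∃ v ∈ od, ι u 4 = 0 ∧ ι u 5 = 0 ∧ ι v 4 = 0 ∧ ι v 5 = 0 ∧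
      ι u 1 * ι v 2 - ι u 2 * ι v 1 = 1 := by
    obtain ⟨_, ⟨x, hx, rfl⟩, _, ⟨y, hy, rfl⟩, h⟩ := exists_minor_ne_zero (K := K)
      (s := ι '' od) (x := ![0, 1, 0, 0, 0, 0]) (y := ![0, 0, 1, 0, 0, 0]) 1 2
      (hspan (mem_odd_iff.2 ⟨rfl, rfl⟩)) (hspan (mem_odd_iff.2 ⟨rfl, rfl⟩)) (by simp)
    obtain ⟨a, b, hab⟩ := hpq _ (hoo _ (heo p hp x hx) _ (heo p hp y hy))
    have h0 := congrFun (congrArg ι hab) 0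
    simp only [hmul, map_add, map_smul, smulK, JW2A.add_apply, mul_apply_zero, mul_apply_one,
      mul_apply_two, p0, p1, p2, q0, (mem_odd_iff.1 (hod x hx)).1,
      (mem_odd_iff.1 (hod y hy)).1] at h0
    have h0' : ι x 1 * ι y 2 - ι x 2 * ι y 1 = algebraMap F K a := by linear_combination h0
    have ha : algebraMap F K a ≠ 0 := h0' ▸ h
    refine ⟨p * x, heo p hp x hx, a⁻¹ • (p * y), od.smul_mem _ (heo p hp y hy), ?_⟩
    simp only [hmul, map_smul, smulK, mul_apply_one, mul_apply_two, mul_apply_four,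
      mul_apply_five, p0, p1, p2, p3, p4, p5, map_inv₀]
    refine ⟨by ring, by ring, by ring, by ring, ?_⟩
    field_simp
    linear_combination h0'
  have right : ∃ u ∈ od, ∃ v ∈ od, ι u 1 = 0 ∧ ι u 2 = 0 ∧ ι v 1 = 0 ∧ ι v 2 = 0 ∧
      ι u 4 * ι v 5 - ι u 5 * ι v 4 = 1 := by
    obtain ⟨_, ⟨x, hx, rfl⟩, _, ⟨y, hy, rfl⟩, h⟩ := exists_minor_ne_zero (K := K)
      (s := ι '' od) (x := ![0, 0, 0, 0, 1, 0]) (y := ![0, 0, 0, 0, 0, 1]) 4 5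
      (hspan (mem_odd_iff.2 ⟨rfl, rfl⟩)) (hspan (mem_odd_iff.2 ⟨rfl, rfl⟩)) (by simp)
    obtain ⟨a, b, hab⟩ := hpq _ (hoo _ (heo q hq x hx) _ (heo q hq y hy))
    have h3 := congrFun (congrArg ι hab) 3
    simp only [hmul, map_add, map_smul, smulK, JW2A.add_apply, mul_apply_three, mul_apply_four,
      mul_apply_five, q3, q4, q5, p3, (mem_odd_iff.1 (hod x hx)).2,
      (mem_odd_iff.1 (hod y hy)).2] at h3
    have h3' : ι x 4 * ι y 5 - ι x 5 * ι y 4 = algebraMap F K b := by linear_combination h3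
    have hb : algebraMap F K b ≠ 0 := h3' ▸ h
    refine ⟨q * x, heo q hq x hx, b⁻¹ • (q * y), od.smul_mem _ (heo q hq y hy), ?_⟩
    simp only [hmul, map_smul, smulK, mul_apply_one, mul_apply_two, mul_apply_four,
      mul_apply_five, q0, q1, q2, q3, q4, q5, map_inv₀]
    refine ⟨by ring, by ring, by ring, by ring, ?_⟩
    field_simp
    linear_combination h3'
  obtain ⟨u, hu, v, hv, u4, u5, v4, v5, huv⟩ := left
  obtain ⟨u', hu', v', hv', u1', u2', v1', v2', huv'⟩ := right
  obtain ⟨u0, u3⟩ := mem_odd_iff.1 (hod u hu)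
  obtain ⟨v0, v3⟩ := mem_odd_iff.1 (hod v hv)
  obtain ⟨u0', u3'⟩ := mem_odd_iff.1 (hod u' hu')
  obtain ⟨v0', v3'⟩ := mem_odd_iff.1 (hod v' hv')
  let ψ : JW2A F →ₗ[F] H :=
    { toFun := fun c => c 0 • p + c 1 • u + c 2 • v + c 3 • q + c 4 • u' + c 5 • v'
      map_add' := fun c d => by simp only [JW2A.add_apply, add_smul]; abel
      map_smul' := fun r c => by
        simp only [JW2A.smul_apply, smul_eq_mul, mul_smul, smul_add, RingHom.id_apply] }
  have hψ : ∀ c, ψ c = c 0 • p + c 1 • u + c 2 • v + c 3 • q + c 4 • u' + c 5 • v' :=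
    fun _ => rfl
  let m : F →+* K := algebraMap F K
  have coords : ∀ c,
      ι (ψ c) 0 = m (c 0) ∧ ι (ψ c) 1 = m (c 1) * ι u 1 + m (c 2) * ι v 1 ∧
      ι (ψ c) 2 = m (c 1) * ι u 2 + m (c 2) * ι v 2 ∧ ι (ψ c) 3 = m (c 3) ∧
      ι (ψ c) 4 = m (c 4) * ι u' 4 + m (c 5) * ι v' 4 ∧
      ι (ψ c) 5 = m (c 4) * ι u' 5 + m (c 5) * ι v' 5 := by
    intro c
    simp only [hψ, map_add, map_smul, JW2A.add_apply, smulK, p0, p1, p2, p3, p4, p5, q0, q1, q2,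
      q3, q4, q5, u0, u3, u4, u5, v0, v3, v4, v5, u0', u1', u2', u3', v0', v1', v2', v3',
      mul_zero, mul_one, add_zero, zero_add, m, and_self]
  have hψmul : ∀ c d, ψ (c * d) = ψ c * ψ d := by
    intro c d
    apply hinj
    rw [hmul]
    obtain ⟨c0, c1, c2, c3, c4, c5⟩ := coords c
    obtain ⟨d0, d1, d2, d3, d4, d5⟩ := coords d
    obtain ⟨k0, k1, k2, k3, k4, k5⟩ := coords (c * d)
    simp only [mul_apply_zero, mul_apply_one, mul_apply_two, mul_apply_three, mul_apply_four,
      mul_apply_five, map_add, map_sub, map_mul] at k0 k1 k2 k3 k4 k5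
    apply ext_coords
    · rw [k0, mul_apply_zero, c0, c1, c2, d0, d1, d2]
      linear_combination (m (c 2) * m (d 1) - m (c 1) * m (d 2)) * huv
    · rw [k1, mul_apply_one, c0, c1, d0, d1]; ring
    · rw [k2, mul_apply_two, c0, c2, d0, d2]; ring
    · rw [k3, mul_apply_three, c3, c4, c5, d3, d4, d5]
      linear_combination (m (c 5) * m (d 4) - m (c 4) * m (d 5)) * huv'
    · rw [k4, mul_apply_four, c3, c4, d3, d4]; ring
    · rw [k5, mul_apply_five, c3, c5, d3, d5]; ring
  have hψinj : Function.Injective ψ := by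
    rw [injective_iff_map_eq_zero]
    intro c hc
    obtain ⟨c0, c1, c2, c3, c4, c5⟩ := coords c
    simp only [hc, map_zero, JW2A.zero_apply] at c0 c1 c2 c3 c4 c5
    have inj : ∀ {t : F}, m t = 0 → t = 0 := fun h => (map_eq_zero m).1 h
    apply ext_coords <;> apply inj
    · exact c0.symm
    · linear_combination -ι v 2 * c1 + ι v 1 * c2 - m (c 1) * huv
    · linear_combination ι u 2 * c1 - ι u 1 * c2 - m (c 2) * huv
    · exact c3.symm
    · linear_combination -ι v' 5 * c4 + ι v' 4 * c5 - m (c 4) * huv'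
    · linear_combination ι u' 5 * c4 - ι u' 4 * c5 - m (c 5) * huv'
  have : FiniteDimensional F (JW2A F) := inferInstanceAs (FiniteDimensional F (Fin 6 → F))
  have hdim' : Module.finrank F (JW2A F) = Module.finrank F H := by
    rw [hdim]
    exact (Module.finrank_fin_fun F : Module.finrank F (Fin 6 → F) = 6)
  let E := LinearMap.linearEquivOfInjective ψ hψinj hdim'
  have hE : ∀ c, E c = ψ c := fun _ => rfl
  have hψev : ∀ c ∈ JW2A.even F F, ψ c ∈ ev := by
    intro c hc
    obtain ⟨h1, h2, h4, h5⟩ := mem_even_iff.1 hc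
    simp only [hψ, h1, h2, h4, h5, zero_smul, add_zero]
    exact add_mem (ev.smul_mem _ hp) (ev.smul_mem _ hq)
  have hψod : ∀ c ∈ JW2A.odd F F, ψ c ∈ od := by
    intro c hc
    obtain ⟨h0, h3⟩ := mem_odd_iff.1 hc
    simp only [hψ, h0, h3, zero_smul, add_zero, zero_add]
    exact add_mem (add_mem (add_mem (od.smul_mem _ hu) (od.smul_mem _ hv))
      (od.smul_mem _ hu')) (od.smul_mem _ hv')
  have decomp : ∀ c : JW2A F, ∃ a ∈ JW2A.even F F, ∃ b ∈ JW2A.odd F F, c = a + b := by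
    intro c
    refine ⟨![c 0, 0, 0, c 3, 0, 0], mem_even_iff.2 ⟨rfl, rfl, rfl, rfl⟩,
      ![0, c 1, c 2, 0, c 4, c 5], mem_odd_iff.2 ⟨rfl, rfl⟩, ?_⟩
    exact ext_coords (add_zero _).symm (zero_add _).symm (zero_add _).symm (add_zero _).symm
      (zero_add _).symm (zero_add _).symm
  have zero_of_mem : ∀ z ∈ ev, z ∈ od → z = 0 := by
    intro z h h'
    have : z ∈ ev ⊓ od := ⟨h, h'⟩
    rwa [hdisj, Submodule.mem_bot] at this
  refine ⟨⟨E.symm, ?_, ?_, ?_⟩⟩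
  · intro x y
    apply E.injective
    rw [E.apply_symm_apply, hE, hψmul, ← hE, ← hE, E.apply_symm_apply, E.apply_symm_apply]
  · ext c
    rw [Submodule.mem_map_equiv, E.symm_symm, hE]
    refine ⟨fun h => ?_, hψev c⟩
    obtain ⟨a, ha, b, hb, rfl⟩ := decomp c
    rw [map_add] at h
    have hb0 := zero_of_mem _ ((Submodule.add_mem_iff_right _ (hψev a ha)).1 h) (hψod b hb)
    rw [(map_eq_zero_iff ψ hψinj).1 hb0, add_zero]
    exact ha
  · ext c
    rw [Submodule.mem_map_equiv, E.symm_symm, hE]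
    refine ⟨fun h => ?_, hψod c⟩
    obtain ⟨a, ha, b, hb, rfl⟩ := decomp c
    rw [map_add] at h
    have ha0 := zero_of_mem _ (hψev a ha) ((Submodule.add_mem_iff_left _ (hψod b hb)).1 h)
    rw [(map_eq_zero_iff ψ hψinj).1 ha0, zero_add]
    exact hb

end Descent

end Kac

/-! ### STATEMENT 5 -/

open Kac in
/-- Let `H` be a twisted form of `J(W) × J(W)` over `F`.  If the even part
`H₀` is isomorphic to `F × F` as an `F`-algebra, then `H` is isomorphic to
`J(W) × J(W)` as an `F`-superalgebra.  Here `(J(W) × J(W)) ⊗_F F̄` is realized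
as `JW2A F̄` and `J(W) × J(W)` as `JW2A F`. -/
theorem twisted_form_JW2_with_split_even_part_is_trivial
    (F : Type) [Field F] (hchar : (2 : F) ≠ 0)
    (H : Type) [NonUnitalNonAssocRing H] [Module F H]
    [SMulCommClass F H H] [IsScalarTower F H H] [FiniteDimensional F H]
    (evH odH : Submodule F H) (hsuper : IsSuperalgebra F H evH odH)
    (htwist : Nonempty (SuperIso (AlgebraicClosure F)
      ((AlgebraicClosure F) ⊗[F] H) (JW2A (AlgebraicClosure F))
      (evH.baseChange (AlgebraicClosure F)) (odH.baseChange (AlgebraicClosure F))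
      (JW2A.even (AlgebraicClosure F) (AlgebraicClosure F))
      (JW2A.odd (AlgebraicClosure F) (AlgebraicClosure F))))
    (heven : SubAlgIso F H (F × F) evH) :
    Nonempty (SuperIso F H (JW2A F) evH odH (JW2A.even F F) (JW2A.odd F F)) := by
  obtain ⟨φ⟩ := htwist
  let K := AlgebraicClosure F
  have : IsScalarTower F K (JW2A K) := inferInstanceAs (IsScalarTower F K (Fin 6 → K))
  let ι : H →ₗ[F] JW2A K := φ.e.toLinearMap.restrictScalars F ∘ₗ TensorProduct.mk F K H 1
  have hι : ∀ x, ι x = φ.e (1 ⊗ₜ x) := fun _ => rfl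
  have hdim : Module.finrank F H = 6 := by
    rw [← Module.finrank_baseChange (R := K), φ.e.finrank_eq]
    exact (Module.finrank_fin_fun K : Module.finrank K (Fin 6 → K) = 6)
  refine nonempty_superIso_of_embedding hsuper heven hdim ι ?_ ?_ ?_ ?_ ?_
  · exact φ.e.injective.comp
      (Module.FaithfullyFlat.tensorProduct_mk_injective (A := F) (B := K) H)
  · intro x y
    rw [hι, hι, hι, ← φ.map_mul', Algebra.TensorProduct.tmul_mul_tmul, one_mul]
  · intro x hx
    rw [← φ.map_even]
    exact Submodule.mem_map_of_mem (Submodule.tmul_mem_baseChange_of_mem 1 hx)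
  · intro x hx
    rw [← φ.map_odd]
    exact Submodule.mem_map_of_mem (Submodule.tmul_mem_baseChange_of_mem 1 hx)
  · refine φ.map_odd.ge.trans (le_of_eq ?_)
    refine (congrArg _ (Submodule.baseChange_eq_span K odH)).trans ?_
    rw [Submodule.map_span, Submodule.map_coe, ← Set.image_comp]
    rfl
end
end
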